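/- Fix τ ∈ (0,1) and σ > 0, and set λ = (1−2τ)/(τ(1−τ)) and δ = 2/(τ(1−τ)). Then for every ξ ∈ ℝ, ∫_0^∞ (2π δ σ ω)^{-1/2} exp(−(ξ − λω)²/(2δσω)) · σ^{-1} exp(−ω/σ) dω = (τ(1−τ)/σ) exp(−ρ_τ(ξ)/σ). That is, the location-scale continuous mixture of normal densities with location λω, variance δσω, and exponential mixing distribution with mean σ equals the centred asymmetric Laplace density with quantile level τ and scale σ. -/

import Mathlib

open Real MeasureTheory Filter Topology

noncomputable def gInt (x : ℝ) : ℝ := ∫ t in (0:ℝ)..x, Real.exp (-t ^ 2)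

lemma gInt_deriv (x : ℝ) : HasDerivAt gInt (Real.exp (-x ^ 2)) x := by
  have hc : Continuous fun t : ℝ => Real.exp (-t ^ 2) := by fun_prop
  exact intervalIntegral.integral_hasDerivAt_right (hc.intervalIntegrable _ _)
    hc.stronglyMeasurable.stronglyMeasurableAtFilter hc.continuousAt

lemma gInt_top : Tendsto gInt atTop (𝓝 (√π / 2)) := by
  have h := intervalIntegral_tendsto_integral_Ioi (μ := volume)
    (f := fun t : ℝ => Real.exp (-1 * t ^ 2)) 0
    (integrable_exp_neg_mul_sq one_pos).integrableOn tendsto_id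
  rw [integral_gaussian_Ioi] at h
  simpa [show gInt = fun x => ∫ t in (0:ℝ)..x, Real.exp (-t ^ 2) from rfl] using h

lemma gInt_neg (x : ℝ) : gInt (-x) = - gInt x := by
  have h := intervalIntegral.integral_comp_neg (a := 0) (b := x) (fun t : ℝ => Real.exp (-t ^ 2))
  simp only [neg_sq, neg_zero] at h
  rw [gInt, gInt, h, intervalIntegral.integral_symm]

lemma gInt_bot : Tendsto gInt atBot (𝓝 (-(√π / 2))) := by
  have h := (gInt_top.comp tendsto_neg_atBot_atTop).neg
  refine h.congr fun x => ?_
  simp [gInt_neg]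

noncomputable def mixF (b c ω : ℝ) : ℝ :=
  (1 / b) * (Real.exp (-(2 * b * c)) * gInt (b * √ω - c * (√ω)⁻¹)
    + Real.exp (2 * b * c) * gInt (b * √ω + c * (√ω)⁻¹))

lemma mixF_eq (b c : ℝ) : mixF b c = fun ω => (1 / b) *
    (Real.exp (-(2 * b * c)) * gInt (b * √ω - c * (√ω)⁻¹)
    + Real.exp (2 * b * c) * gInt (b * √ω + c * (√ω)⁻¹)) := rfl

lemma mixF_deriv (b c ω : ℝ) (hb : 0 < b) (hω : 0 < ω) :
    HasDerivAt (mixF b c) ((√ω)⁻¹ * Real.exp (-(b ^ 2 * ω) - c ^ 2 / ω)) ω := by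
  have hs : HasDerivAt (fun w : ℝ => √w) (1 / (2 * √ω)) ω := Real.hasDerivAt_sqrt hω.ne'
  have hp : 0 < √ω := Real.sqrt_pos.2 hω
  have hi := hs.inv hp.ne'
  have h1 := (gInt_deriv _).comp ω ((hs.const_mul b).sub (hi.const_mul c))
  have h2 := (gInt_deriv _).comp ω ((hs.const_mul b).add (hi.const_mul c))
  have h := ((h1.const_mul (Real.exp (-(2 * b * c)))).add
    (h2.const_mul (Real.exp (2 * b * c)))).const_mul (1 / b)
  refine h.congr_deriv ?_
  have hsq : √ω ^ 2 = ω := Real.sq_sqrt hω.le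
  simp only [Pi.sub_apply, Pi.add_apply, Pi.inv_apply]
  generalize √ω = s at *
  subst hsq
  have e1 : Real.exp (-(2 * b * c)) * Real.exp (-(b * s - c * s⁻¹) ^ 2)
      = Real.exp (-(b ^ 2 * s ^ 2) - c ^ 2 / s ^ 2) := by
    rw [← Real.exp_add]; congr 1; field_simp; ring
  have e2 : Real.exp (2 * b * c) * Real.exp (-(b * s + c * s⁻¹) ^ 2)
      = Real.exp (-(b ^ 2 * s ^ 2) - c ^ 2 / s ^ 2) := by
    rw [← Real.exp_add]; congr 1; field_simp; ring
  rw [← mul_assoc, ← mul_assoc, e1, e2]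
  field_simp
  ring

lemma sqrt_inv_top : Tendsto (fun w : ℝ => (√w)⁻¹) atTop (𝓝 0) :=
  tendsto_inv_atTop_zero.comp Real.tendsto_sqrt_atTop

lemma sqrt_zero : Tendsto (fun w : ℝ => √w) (𝓝[>] 0) (𝓝 0) := by
  have := (Real.continuous_sqrt.tendsto 0).mono_left (nhdsWithin_le_nhds (s := Set.Ioi 0))
  simpa using this

lemma sqrt_inv_zero : Tendsto (fun w : ℝ => (√w)⁻¹) (𝓝[>] 0) atTop := by
  refine tendsto_inv_nhdsGT_zero.comp (tendsto_nhdsWithin_iff.2 ⟨sqrt_zero, ?_⟩)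
  filter_upwards [self_mem_nhdsWithin] with w hw using Real.sqrt_pos.2 hw

lemma mixF_top (b c : ℝ) (hb : 0 < b) : Tendsto (mixF b c) atTop
    (𝓝 ((1 / b) * (Real.exp (-(2 * b * c)) * (√π / 2) + Real.exp (2 * b * c) * (√π / 2)))) := by
  have t1 : Tendsto (fun w : ℝ => b * √w) atTop atTop :=
    Real.tendsto_sqrt_atTop.const_mul_atTop hb
  have t2 := sqrt_inv_top.const_mul c
  have h1 := gInt_top.comp (t1.atTop_add t2.neg)
  have h2 := gInt_top.comp (t1.atTop_add t2)
  simpa [mixF_eq, Function.comp_def, sub_eq_add_neg] using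
    ((h1.const_mul (Real.exp (-(2 * b * c)))).add
    (h2.const_mul (Real.exp (2 * b * c)))).const_mul (1 / b)

lemma mixF_zero (b c : ℝ) (hc : 0 ≤ c) : Tendsto (mixF b c) (𝓝[>] 0)
    (𝓝 ((1 / b) * (Real.exp (2 * b * c) - Real.exp (-(2 * b * c))) * (√π / 2))) := by
  have t1 := sqrt_zero.const_mul b
  rcases hc.eq_or_lt with rfl | hc
  · have h1 := (gInt_deriv (b * 0)).continuousAt.tendsto.comp t1
    have h := ((h1.const_mul 1).add (h1.const_mul 1)).const_mul (1 / b)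
    have g0 : gInt 0 = 0 := by simp [gInt]
    simpa [mixF_eq, Function.comp_def, g0] using h
  · have t2 := sqrt_inv_zero.const_mul_atTop hc
    have h1 := gInt_bot.comp (t1.add_atBot (tendsto_neg_atTop_atBot.comp t2))
    have h2 := gInt_top.comp (t1.add_atTop t2)
    have h := ((h1.const_mul (Real.exp (-(2 * b * c)))).add
      (h2.const_mul (Real.exp (2 * b * c)))).const_mul (1 / b)
    have e : (1 / b) * (Real.exp (2 * b * c) - Real.exp (-(2 * b * c))) * (√π / 2)
      = (1 / b) * (Real.exp (-(2 * b * c)) * (-(√π / 2)) + Real.exp (2 * b * c) * (√π / 2)) := by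
      ring
    rw [e]
    simpa only [mixF_eq, Function.comp_def, sub_eq_add_neg] using h

lemma key_integral (b c : ℝ) (hb : 0 < b) (hc : 0 ≤ c) :
    ∫ ω in Set.Ioi (0:ℝ), (√ω)⁻¹ * Real.exp (-(b ^ 2 * ω) - c ^ 2 / ω)
      = √π / b * Real.exp (-(2 * b * c)) := by
  set A := (1 / b) * (Real.exp (2 * b * c) - Real.exp (-(2 * b * c))) * (√π / 2) with hA
  have hcont : ContinuousWithinAt (Function.update (mixF b c) 0 A) (Set.Ici 0) 0 := by
    rw [continuousWithinAt_update_same, Set.Ici_sdiff_left]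
    exact mixF_zero b c hc
  have hd : ∀ x ∈ Set.Ioi (0:ℝ), HasDerivAt (Function.update (mixF b c) 0 A)
      ((√x)⁻¹ * Real.exp (-(b ^ 2 * x) - c ^ 2 / x)) x := by
    intro x hx
    refine (mixF_deriv b c x hb hx).congr_of_eventuallyEq ?_
    filter_upwards [isOpen_ne.mem_nhds (ne_of_gt hx)] with y hy
    exact Function.update_of_ne hy _ _
  have ht : Tendsto (Function.update (mixF b c) 0 A) atTop
    (𝓝 ((1 / b) * (Real.exp (-(2 * b * c)) * (√π / 2) + Real.exp (2 * b * c) * (√π / 2)))) := by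
    refine (mixF_top b c hb).congr' ?_
    filter_upwards [eventually_gt_atTop 0] with y hy
    exact (Function.update_of_ne hy.ne' _ _).symm
  rw [integral_Ioi_of_hasDerivAt_of_nonneg hcont hd (fun x _ => by positivity) ht,
    Function.update_self, hA]
  ring

/-- The quantile check loss `ρ_τ(u) = u (τ - 1_{u<0})`. -/
noncomputable def checkLoss (τ u : ℝ) : ℝ := u * (τ - if u < 0 then 1 else 0)

/-- The location-scale continuous mixture of normal densities with location `λω`,
variance `δσω` and exponential mixing distribution with mean `σ` equals the centred
asymmetric Laplace density with quantile level `τ` and scale `σ`. -/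
theorem ald_normal_exponential_mixture (τ σ lam delta : ℝ)
    (hτ : τ ∈ Set.Ioo (0:ℝ) 1) (hσ : 0 < σ)
    (hlam : lam = (1 - 2 * τ) / (τ * (1 - τ)))
    (hdelta : delta = 2 / (τ * (1 - τ))) (ξ : ℝ) :
    ∫ ω in Set.Ioi (0:ℝ),
        (Real.sqrt (2 * Real.pi * delta * σ * ω))⁻¹ *
          Real.exp (-(ξ - lam * ω) ^ 2 / (2 * delta * σ * ω)) *
          (σ⁻¹ * Real.exp (-ω / σ))
      = (τ * (1 - τ) / σ) * Real.exp (-(checkLoss τ ξ) / σ) := by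
  obtain ⟨h0, h1⟩ := hτ
  have h1' : 0 < 1 - τ := by linarith
  have hp : 0 < τ * (1 - τ) := by positivity
  have hq : 0 < √(τ * (1 - τ)) := Real.sqrt_pos.2 hp
  have hr : 0 < √σ := Real.sqrt_pos.2 hσ
  have hπ : 0 < √π := Real.sqrt_pos.2 Real.pi_pos
  have hq2 : √(τ * (1 - τ)) ^ 2 = τ * (1 - τ) := Real.sq_sqrt hp.le
  have hr2 : √σ ^ 2 = σ := Real.sq_sqrt hσ.le
  set q := √(τ * (1 - τ)) with hqd
  set r := √σ with hrd
  have hk := key_integral (1 / (2 * q * r)) (|ξ| * q / (2 * r)) (by positivity) (by positivity)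
  have hint : ∀ ω ∈ Set.Ioi (0:ℝ), (Real.sqrt (2 * Real.pi * delta * σ * ω))⁻¹ *
          Real.exp (-(ξ - lam * ω) ^ 2 / (2 * delta * σ * ω)) *
          (σ⁻¹ * Real.exp (-ω / σ)) =
      (q / (2 * √π * r * σ) * Real.exp (ξ * (1 - 2 * τ) / (2 * σ))) * ((√ω)⁻¹ *
        Real.exp (-((1 / (2 * q * r)) ^ 2 * ω) - (|ξ| * q / (2 * r)) ^ 2 / ω)) := by
    intro ω hω
    have hω : 0 < ω := hω
    have es : √(2 * π * delta * σ * ω) = 2 * √π * r / q * √ω := by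
      rw [Real.sqrt_eq_iff_mul_self_eq (by rw [hdelta]; positivity) (by positivity)]
      have a := Real.sq_sqrt Real.pi_pos.le
      have d := Real.sq_sqrt hω.le
      symm
      calc _ = 4 * (√π ^ 2) * r ^ 2 / q ^ 2 * √ω ^ 2 := by ring
        _ = _ := by rw [a, d, hr2, hq2, hdelta]; ring
    have ee : Real.exp (-(ξ - lam * ω) ^ 2 / (2 * delta * σ * ω)) * Real.exp (-ω / σ)
        = Real.exp (ξ * (1 - 2 * τ) / (2 * σ)) *
        Real.exp (-((1 / (2 * q * r)) ^ 2 * ω) - (|ξ| * q / (2 * r)) ^ 2 / ω) := by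
      rw [← Real.exp_add, ← Real.exp_add]
      congr 1
      simp only [div_pow, mul_pow, sq_abs, hq2, hr2, hlam, hdelta]
      field_simp
      ring
    rw [es]
    calc _ = (2 * √π * r / q * √ω)⁻¹ * σ⁻¹ * (Real.exp (-(ξ - lam * ω) ^ 2 / (2 * delta * σ * ω)) * Real.exp (-ω / σ)) := by ring
      _ = _ := by rw [ee]; field_simp
  rw [setIntegral_congr_fun measurableSet_Ioi hint, integral_const_mul, hk]
  have e3 : Real.exp (ξ * (1 - 2 * τ) / (2 * σ)) *
      Real.exp (-(2 * (1 / (2 * q * r)) * (|ξ| * q / (2 * r))))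
      = Real.exp (-(checkLoss τ ξ) / σ) := by
    rw [← Real.exp_add]
    congr 1
    have : 2 * (1 / (2 * q * r)) * (|ξ| * q / (2 * r)) = |ξ| / (2 * σ) := by
      rw [← hr2]; field_simp
    rw [this, checkLoss]
    split_ifs with h
    · rw [abs_of_neg h]; field_simp; ring
    · rw [abs_of_nonneg (not_lt.1 h)]; field_simp; ring
  rw [← e3, ← hq2]
  field_simp
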